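/- Let D be a data set with n observations taking at least two distinct values. There exist positive constants C(D) and E(D), depending only on D, such that for every accuracy ε ≤ E(D) for which L/ε is an integer, every optimal histogram M* for D on the ε-grid (with K intervals) satisfies |c_Enum(M*|D) − (K − 1 + n − S(M*,D))·log(1/ε)| ≤ C(D). -/

import Mathlib

open Real Finset

/-- Rissanen's universal code length for integers:
`log*(K) = log₂(2.865) + Σ_{j≥1} max(log₂^{(j)}(K), 0)`. -/
noncomputable def logStar (K : ℕ) : ℝ :=
  Real.logb 2 2.865 + ∑' j : ℕ, max ((fun x => Real.logb 2 x)^[j + 1] (K : ℝ)) 0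

/-- A histogram model on the ε-grid built on the data range `[xmin, xmax]`,
with `E` elementary ε-bins.  Intervals are `]c k, c (k+1)]` for `k < K`, with
count `h k`; the counts sum to `n`. -/
structure Histogram (n : ℕ) (ε xmin xmax : ℝ) (E : ℕ) where
  K : ℕ
  c : ℕ → ℝ
  h : ℕ → ℕ
  K_pos : 1 ≤ K
  c_mono : ∀ k < K, c k ≤ c (k + 1)
  c_first : c 0 = xmin - ε / 2
  c_last : c K = xmax + ε / 2
  c_grid : ∀ k ≤ K, ∃ t : ℕ, t ≤ E ∧ c k = xmin - ε / 2 + t * ε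
  h_sum : ∑ k ∈ Finset.range K, h k = n

namespace Histogram

variable {n : ℕ} {ε xmin xmax : ℝ} {E : ℕ}

open Classical in
/-- Compatibility of a histogram with a data set: the count of each
interval matches the number of observations that fall in it. -/
def Compatible (D : Fin n → ℝ) (M : Histogram n ε xmin xmax E) : Prop :=
  ∀ k < M.K,
    (Finset.univ.filter fun i => D i ∈ Set.Ioc (M.c k) (M.c (k + 1))).card = M.h k

/-- The Enum MDL criterion for histogram selection. -/
noncomputable def cEnum (M : Histogram n ε xmin xmax E) : ℝ :=
  logStar M.K + Real.log (Nat.choose (E + M.K - 1) (M.K - 1))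
    + Real.log (Nat.choose (n + M.K - 1) (M.K - 1))
    + (Real.log (Nat.factorial n)
        - ∑ k ∈ Finset.range M.K, Real.log (Nat.factorial (M.h k)))
    + ∑ k ∈ Finset.range M.K, (M.h k : ℝ) * Real.log ((M.c (k + 1) - M.c k) / ε)

/-- A histogram is optimal for `D` if it is compatible with `D` and minimizes
the Enum criterion among all compatible histograms on the same grid. -/
def Optimal (D : Fin n → ℝ) (M : Histogram n ε xmin xmax E) : Prop :=
  M.Compatible D ∧
    ∀ M' : Histogram n ε xmin xmax E, M'.Compatible D → M.cEnum ≤ M'.cEnum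

end Histogram


namespace Histogram

variable {n : ℕ} {ε xmin xmax : ℝ} {E : ℕ}

open Classical in
/-- The number `S(M, D)` of data points lying in singular intervals of `M`:
intervals of width exactly ε, non empty, whose observations are all equal. -/
noncomputable def singCount (D : Fin n → ℝ) (M : Histogram n ε xmin xmax E) : ℕ :=
  ∑ k ∈ Finset.range M.K,
    if M.c (k + 1) - M.c k = ε ∧ 0 < M.h k ∧
        ∀ i j : Fin n, D i ∈ Set.Ioc (M.c k) (M.c (k + 1)) →
          D j ∈ Set.Ioc (M.c k) (M.c (k + 1)) → D i = D j
    then M.h k else 0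

end Histogram

lemma h9_grid {n : ℕ} {ε xmin xmax : ℝ} {E : ℕ} (hε : 0 < ε) (M : Histogram n ε xmin xmax E)
    (k : ℕ) (hk : k < M.K) : ∃ m : ℕ, M.c (k + 1) - M.c k = m * ε := by
  obtain ⟨t, -, ht⟩ := M.c_grid k hk.le
  obtain ⟨s, -, hs⟩ := M.c_grid (k + 1) hk
  have h := M.c_mono k hk
  rw [ht, hs] at h
  have h1 : (t : ℝ) ≤ s := by
    have : (t : ℝ) * ε ≤ s * ε := by linarith
    exact le_of_mul_le_mul_right this hε
  have h2 : t ≤ s := by exact_mod_cast h1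
  refine ⟨s - t, ?_⟩
  rw [ht, hs, Nat.cast_sub h2]; ring

lemma h9_mono {n : ℕ} {ε xmin xmax : ℝ} {E : ℕ} (M : Histogram n ε xmin xmax E)
    (a b : ℕ) (hab : a ≤ b) (hb : b ≤ M.K) : M.c a ≤ M.c b := by
  induction b, hab using Nat.le_induction with
  | base => exact le_rfl
  | succ b hab ih => exact (ih (by omega)).trans (M.c_mono b (by omega))

lemma h9_exch {n : ℕ} {ε xmin xmax : ℝ} {E : ℕ} (D : Fin n → ℝ) (M : Histogram n ε xmin xmax E)
    (hM : M.Optimal D) (k : ℕ) (hk : k + 1 < M.K) (c' : ℝ) (h1 : M.c k ≤ c')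
    (h2 : c' ≤ M.c (k + 2)) (hg : ∃ t : ℕ, t ≤ E ∧ c' = xmin - ε / 2 + t * ε)
    (hD : ∀ i, D i ≤ c' ↔ D i ≤ M.c (k + 1)) :
    (M.h k : ℝ) * Real.log ((M.c (k + 1) - M.c k) / ε)
      + (M.h (k + 1) : ℝ) * Real.log ((M.c (k + 2) - M.c (k + 1)) / ε) ≤
    (M.h k : ℝ) * Real.log ((c' - M.c k) / ε)
      + (M.h (k + 1) : ℝ) * Real.log ((M.c (k + 2) - c') / ε) := by
  classical
  have hD' : ∀ j i, D i ≤ Function.update M.c (k + 1) c' j ↔ D i ≤ M.c j := by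
    intro j i
    by_cases hj : j = k + 1
    · subst hj; simpa using hD i
    · rw [Function.update_of_ne hj]
  let M' : Histogram n ε xmin xmax E :=
    { K := M.K
      c := Function.update M.c (k + 1) c'
      h := M.h
      K_pos := M.K_pos
      c_mono := by
        intro j hj
        by_cases e1 : j = k + 1
        · subst e1
          rw [Function.update_self, Function.update_of_ne (by omega)]; exact h2
        · by_cases e2 : j = k
          · subst e2
            rw [Function.update_self, Function.update_of_ne (by omega)]; exact h1
          · rw [Function.update_of_ne e1, Function.update_of_ne (by omega)]
            exact M.c_mono j hj
      c_first := by rw [Function.update_of_ne (by omega)]; exact M.c_first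
      c_last := by rw [Function.update_of_ne (by omega)]; exact M.c_last
      c_grid := by
        intro j hj
        by_cases e1 : j = k + 1
        · subst e1; rw [Function.update_self]; exact hg
        · rw [Function.update_of_ne e1]; exact M.c_grid j hj
      h_sum := M.h_sum }
  have hc : M'.Compatible D := by
    intro j hj
    rw [show M'.h j = M.h j from rfl, ← hM.1 j hj]
    congr 1
    ext i
    simp only [Finset.mem_filter, Finset.mem_univ, true_and, Set.mem_Ioc]
    have a := hD' j i
    have b := hD' (j + 1) i
    change Function.update M.c (k + 1) c' j < D i ∧ D i ≤ Function.update M.c (k + 1) c' (j + 1) ↔ _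
    rw [← not_le, a, b, not_le]
  have hle := hM.2 M' hc
  have key : ∑ j ∈ Finset.range M.K, (M.h j : ℝ) * Real.log ((M.c (j + 1) - M.c j) / ε) ≤
      ∑ j ∈ Finset.range M.K, (M.h j : ℝ) * Real.log ((Function.update M.c (k + 1) c' (j + 1) - Function.update M.c (k + 1) c' j) / ε) := by
    simp only [Histogram.cEnum, M'] at hle
    linarith
  have m1 : k ∈ Finset.range M.K := by simp; omega
  have m2 : k + 1 ∈ (Finset.range M.K).erase k := by simp; omega
  rw [← Finset.add_sum_erase _ _ m1, ← Finset.add_sum_erase _ _ m2,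
    ← Finset.add_sum_erase _ _ m1, ← Finset.add_sum_erase _ _ m2] at key
  have e : ∀ j ∈ ((Finset.range M.K).erase k).erase (k + 1),
      (M.h j : ℝ) * Real.log ((Function.update M.c (k + 1) c' (j + 1) - Function.update M.c (k + 1) c' j) / ε)
      = (M.h j : ℝ) * Real.log ((M.c (j + 1) - M.c j) / ε) := by
    intro j hj
    simp only [Finset.mem_erase] at hj
    rw [Function.update_of_ne (by omega), Function.update_of_ne (by omega)]
  rw [Finset.sum_congr rfl e] at key
  rw [Function.update_self, Function.update_of_ne (by omega), Function.update_of_ne (by omega)] at key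
  simp only [show k + 1 + 1 = k + 2 from rfl] at key
  linarith

lemma h9_logineq (n h h' : ℕ) (m w : ℝ) (hm : 1 < m) (hw : 0 < w) (hh : 1 ≤ h) (hn : h' ≤ n)
    (H : (h : ℝ) * Real.log m + h' * Real.log w ≤ h * Real.log (m - 1) + h' * Real.log (w + 1)) :
    w ≤ n * m := by
  have a : 1 / m ≤ Real.log m - Real.log (m - 1) := by
    rw [← Real.log_div (by linarith) (by linarith)]
    have := Real.one_sub_inv_le_log_of_pos (x := m / (m - 1)) (by apply div_pos <;> linarith)
    refine le_trans (le_of_eq ?_) this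
    rw [inv_div]; field_simp; ring
  have b : Real.log (w + 1) - Real.log w ≤ 1 / w := by
    rw [← Real.log_div (by linarith) (by linarith)]
    have := Real.log_le_sub_one_of_pos (x := (w + 1) / w) (by apply div_pos <;> linarith)
    refine le_trans this (le_of_eq ?_)
    field_simp; ring
  have hh' : (1 : ℝ) ≤ h := by exact_mod_cast hh
  have hn' : (h' : ℝ) ≤ n := by exact_mod_cast hn
  have c : 1 / m ≤ n * (1 / w) := by
    have p1 : 0 < 1 / m := by positivity
    have p2 : 0 < 1 / w := by positivity
    have : 1 / m ≤ (h : ℝ) * (Real.log m - Real.log (m - 1)) := by nlinarith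
    have : (h' : ℝ) * (Real.log (w + 1) - Real.log w) ≤ h' * (1 / w) := by gcongr
    have : (h' : ℝ) * (1 / w) ≤ n * (1 / w) := by gcongr
    linarith
  rw [mul_one_div, div_le_div_iff₀ (by linarith) hw] at c
  linarith

lemma h9_pos {n : ℕ} {ε xmin xmax : ℝ} {E : ℕ} (D : Fin n → ℝ) (M : Histogram n ε xmin xmax E)
    (hM : M.Compatible D) (k : ℕ) (hk : k < M.K) (h : 0 < M.h k) :
    ∃ i, M.c k < D i ∧ D i ≤ M.c (k + 1) := by
  rw [← hM k hk, Finset.card_pos] at h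
  obtain ⟨i, hi⟩ := h
  simp only [Finset.mem_filter, Finset.mem_univ, true_and, Set.mem_Ioc] at hi
  exact ⟨i, hi⟩

lemma h9_hle {n : ℕ} {ε xmin xmax : ℝ} {E : ℕ} (M : Histogram n ε xmin xmax E) (k : ℕ)
    (hk : k < M.K) : M.h k ≤ n := by
  have := Finset.single_le_sum (f := M.h) (fun i _ => Nat.zero_le _) (Finset.mem_range.2 hk)
  rwa [M.h_sum] at this

lemma h9_wide {n : ℕ} {ε xmin xmax : ℝ} {E : ℕ} (hε : 0 < ε) (D : Fin n → ℝ)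
    (hmin : ∃ i, D i = xmin) (hmax : ∃ i, D i = xmax) (hmin' : ∀ i, xmin ≤ D i)
    (hmax' : ∀ i, D i ≤ xmax) (δ : ℝ) (hδ : 0 < δ)
    (hgap : ∀ i j, D i < D j → δ ≤ D j - D i) (M : Histogram n ε xmin xmax E)
    (hM : M.Optimal D) (k : ℕ) (hk : k < M.K) (hpos : 0 < M.h k)
    (hns : ¬ (M.c (k + 1) - M.c k = ε ∧ 0 < M.h k ∧
        ∀ i j : Fin n, D i ∈ Set.Ioc (M.c k) (M.c (k + 1)) →
          D j ∈ Set.Ioc (M.c k) (M.c (k + 1)) → D i = D j)) :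
    δ / (n + 1) ≤ M.c (k + 1) - M.c k := by
  by_contra hlt
  push Not at hlt
  have hκ : δ / (n + 1) ≤ δ := div_le_self hδ.le (by simp)
  have hκ2 : δ / (n + 1) * n = δ - δ / (n + 1) := by field_simp; ring
  have heq : ∀ i j : Fin n, D i ∈ Set.Ioc (M.c k) (M.c (k + 1)) →
          D j ∈ Set.Ioc (M.c k) (M.c (k + 1)) → D i = D j := by
    intro i j hi hj
    rcases lt_trichotomy (D i) (D j) with h | h | h
    · have := hgap _ _ h; linarith [hi.1, hj.2]
    · exact h
    · have := hgap _ _ h; linarith [hj.1, hi.2]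
  obtain ⟨i, hi1, hi2⟩ := h9_pos D M hM.1 k hk hpos
  obtain ⟨m, hm⟩ := h9_grid hε M k hk
  have hm2 : 2 ≤ m := by
    by_contra hc
    have : m = 0 ∨ m = 1 := by omega
    rcases this with rfl | rfl
    · simp at hm; linarith
    · exact hns ⟨by simpa using hm, hpos, heq⟩
  have hm2' : (2 : ℝ) ≤ m := by exact_mod_cast hm2
  have hmε : 2 * ε ≤ m * ε := by gcongr
  obtain ⟨t0, ht0, hc0⟩ := M.c_grid k hk.le
  obtain ⟨t1, ht1, hc1⟩ := M.c_grid (k + 1) hk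
  have htt : (t0 : ℝ) + m = t1 := by
    have : ((t0 : ℝ) + m) * ε = t1 * ε := by rw [hc0, hc1] at hm; linarith
    exact mul_right_cancel₀ hε.ne' this
  have htt' : t0 + m = t1 := by exact_mod_cast htt
  have em : (M.c (k + 1) - M.c k) / ε = m := by rw [hm]; field_simp
  rcases le_or_gt (D i) (M.c (k + 1) - ε) with hcase | hcase
  · have hk1 : k + 1 < M.K := by
      by_contra hc
      have hK : k + 1 = M.K := by omega
      obtain ⟨j, hj⟩ := hmax
      have hl := M.c_last
      rw [← hK] at hl
      have := heq i j ⟨hi1, hi2⟩ ⟨by linarith [hmax' i], by linarith⟩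
      linarith
    have hmono := M.c_mono (k + 1) hk1
    have H := h9_exch D M hM k hk1 (M.c (k + 1) - ε) (by linarith)
      (by simp only [show k + 1 + 1 = k + 2 from rfl] at hmono; linarith)
      ⟨t1 - 1, by omega, by
        rw [Nat.cast_sub (by omega), hc1]; push_cast; ring⟩ (by
        intro j
        refine ⟨fun h => by linarith, fun h => ?_⟩
        by_contra hc
        push Not at hc
        have := heq i j ⟨hi1, hi2⟩ ⟨by linarith, h⟩
        linarith)
    have e1 : (M.c (k + 1) - ε - M.c k) / ε = m - 1 := by
      rw [← em]; field_simp; ring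
    have e2 : (M.c (k + 2) - (M.c (k + 1) - ε)) / ε = (M.c (k + 2) - M.c (k + 1)) / ε + 1 := by
      field_simp; ring
    rw [em, e1, e2] at H
    rcases Nat.eq_zero_or_pos (M.h (k + 1)) with h0 | h0
    · rw [h0] at H
      have : Real.log ((m : ℝ) - 1) < Real.log m := Real.log_lt_log (by linarith) (by linarith)
      have hp : (0 : ℝ) < M.h k := by exact_mod_cast hpos
      simp at H
      nlinarith
    · obtain ⟨j, hj1, hj2⟩ := h9_pos D M hM.1 (k + 1) hk1 h0
      simp only [show k + 1 + 1 = k + 2 from rfl] at hj2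
      have hg := hgap i j (by linarith)
      have := h9_logineq n (M.h k) (M.h (k + 1)) m ((M.c (k + 2) - M.c (k + 1)) / ε) (by linarith)
        (div_pos (by linarith) hε) hpos (h9_hle M _ hk1) H
      rw [div_le_iff₀ hε, mul_assoc, ← hm] at this
      have : (n : ℝ) * (M.c (k + 1) - M.c k) ≤ n * (δ / (n + 1)) := by gcongr
      linarith
  · have hk0 : k ≠ 0 := by
      rintro rfl
      obtain ⟨j, hj⟩ := hmin
      have hl := M.c_first
      have := heq i j ⟨hi1, hi2⟩ ⟨by linarith, by linarith [hmin' i]⟩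
      linarith
    obtain ⟨l, rfl⟩ := Nat.exists_eq_succ_of_ne_zero hk0
    simp only [Nat.succ_eq_add_one] at *
    simp only [show l + 1 + 1 = l + 2 from rfl] at *
    have hmono := M.c_mono l (by omega)
    have H := h9_exch D M hM l hk (M.c (l + 1) + ε) (by linarith)
      (by linarith)
      ⟨t0 + 1, by omega, by
        rw [hc0]; push_cast; ring⟩ (by
        intro j
        refine ⟨fun h => ?_, fun h => by linarith⟩
        by_contra hc
        push Not at hc
        have := heq i j ⟨hi1, hi2⟩ ⟨hc, by linarith⟩
        linarith)
    have e1 : (M.c (l + 2) - (M.c (l + 1) + ε)) / ε = m - 1 := by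
      rw [← em]; field_simp; ring
    have e2 : (M.c (l + 1) + ε - M.c l) / ε = (M.c (l + 1) - M.c l) / ε + 1 := by
      field_simp; ring
    rw [em, e1, e2] at H
    rcases Nat.eq_zero_or_pos (M.h l) with h0 | h0
    · rw [h0] at H
      have : Real.log ((m : ℝ) - 1) < Real.log m := Real.log_lt_log (by linarith) (by linarith)
      have hp : (0 : ℝ) < M.h (l + 1) := by exact_mod_cast hpos
      simp at H
      nlinarith
    · obtain ⟨j, hj1, hj2⟩ := h9_pos D M hM.1 l (by omega) h0
      have hg := hgap j i (by linarith)
      have := h9_logineq n (M.h (l + 1)) (M.h l) m ((M.c (l + 1) - M.c l) / ε) (by linarith)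
        (div_pos (by linarith) hε) hpos (h9_hle M _ (by omega)) (by linarith)
      rw [div_le_iff₀ hε, mul_assoc, ← hm] at this
      have : (n : ℝ) * (M.c (l + 2) - M.c (l + 1)) ≤ n * (δ / (n + 1)) := by gcongr
      linarith

lemma h9_gap {n : ℕ} (D : Fin n → ℝ) : ∃ δ > 0, ∀ i j, D i < D j → δ ≤ D j - D i := by
  classical
  let s : Finset ℝ := insert 1 (((Finset.univ : Finset (Fin n × Fin n)).filter
    (fun p => D p.1 < D p.2)).image (fun p => D p.2 - D p.1))
  have hs : s.Nonempty := ⟨1, by simp [s]⟩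
  refine ⟨s.min' hs, ?_, ?_⟩
  · have := s.min'_mem hs
    simp only [s, Finset.mem_insert, Finset.mem_image, Finset.mem_filter, Finset.mem_univ,
      true_and] at this
    rcases this with h | ⟨p, hp, h⟩
    · simp only [s]; rw [h]; exact one_pos
    · simp only [s]; rw [← h]; simpa using hp
  · intro i j hij
    apply Finset.min'_le
    simp only [s, Finset.mem_insert, Finset.mem_image, Finset.mem_filter, Finset.mem_univ,
      true_and]
    exact Or.inr ⟨(i, j), hij, rfl⟩

lemma h9_logStar (K : ℕ) : 0 ≤ logStar K := by
  unfold logStar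
  apply add_nonneg
  · exact Real.logb_nonneg (by norm_num) (by norm_num)
  · exact tsum_nonneg (fun j => le_max_right _ _)

lemma h9_multi {n : ℕ} {ε xmin xmax : ℝ} {E : ℕ} (M : Histogram n ε xmin xmax E) :
    0 ≤ Real.log (Nat.factorial n) - ∑ k ∈ Finset.range M.K, Real.log (Nat.factorial (M.h k)) ∧
    Real.log (Nat.factorial n) - ∑ k ∈ Finset.range M.K, Real.log (Nat.factorial (M.h k))
      ≤ Real.log (Nat.factorial n) := by
  constructor
  · rw [sub_nonneg, ← Real.log_prod (fun i _ => by exact_mod_cast Nat.factorial_ne_zero _)]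
    apply Real.log_le_log
    · exact Finset.prod_pos (fun i _ => by exact_mod_cast Nat.factorial_pos _)
    · have := Nat.le_of_dvd (Nat.factorial_pos _)
        (Nat.prod_factorial_dvd_factorial_sum (Finset.range M.K) M.h)
      rw [M.h_sum] at this
      exact_mod_cast this
  · have : 0 ≤ ∑ k ∈ Finset.range M.K, Real.log (Nat.factorial (M.h k)) :=
      Finset.sum_nonneg (fun i _ => Real.log_natCast_nonneg _)
    linarith

lemma h9_sumnn {n : ℕ} {ε xmin xmax : ℝ} {E : ℕ} (hε : 0 < ε) (M : Histogram n ε xmin xmax E) :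
    0 ≤ ∑ k ∈ Finset.range M.K, (M.h k : ℝ) * Real.log ((M.c (k + 1) - M.c k) / ε) := by
  apply Finset.sum_nonneg
  intro k hk
  obtain ⟨m, hm⟩ := h9_grid hε M k (Finset.mem_range.1 hk)
  rw [hm, mul_div_cancel_right₀ _ hε.ne']
  exact mul_nonneg (Nat.cast_nonneg _) (Real.log_natCast_nonneg _)

lemma h9_choose_lb (E m : ℕ) (hE : 1 ≤ E) :
    m * Real.log E - Real.log (Nat.factorial m) ≤ Real.log (Nat.choose (E + m) m) := by
  have h := Nat.pow_le_choose (α := ℝ) m (E + m)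
  have hE' : (0 : ℝ) < E := by exact_mod_cast hE
  have hf : (0 : ℝ) < Nat.factorial m := by exact_mod_cast Nat.factorial_pos m
  rw [← Real.log_pow, ← Real.log_div (by positivity) (by positivity)]
  apply Real.log_le_log (by positivity)
  refine le_trans ?_ h
  gcongr
  omega

lemma h9_choose_ub (E m : ℕ) (hE : 1 ≤ E) :
    Real.log (Nat.choose (E + m) m) ≤ m * Real.log E + m * Real.log 2 := by
  have h := Nat.choose_add_le_add_one_pow E m
  have hE' : (0 : ℝ) < E := by exact_mod_cast hE
  have h2 : (E + 1) ^ m ≤ (E * 2) ^ m := Nat.pow_le_pow_left (by omega) m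
  rw [← mul_add, ← Real.log_mul (by positivity) (by positivity), ← Real.log_pow]
  apply Real.log_le_log
  · exact_mod_cast Nat.choose_pos (by omega)
  · exact_mod_cast h.trans h2

lemma h9_Kbound {n : ℕ} {ε xmin xmax : ℝ} {E : ℕ} (hε : 0 < ε) (hE : 1 ≤ E)
    (hEe : (E : ℝ) = 1 + (xmax - xmin) / ε) (D : Fin n → ℝ)
    (hmin' : ∀ i, xmin ≤ D i) (hmax' : ∀ i, D i ≤ xmax) (M : Histogram n ε xmin xmax E)
    (hM : M.Optimal D)
    (hbig : logStar 1 + Real.log (Nat.factorial (n + 1)) < Real.log E) : M.K ≤ n + 1 := by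
  classical
  by_contra hK
  push Not at hK
  have hEε : (E : ℝ) * ε = ε + (xmax - xmin) := by rw [hEe]; field_simp
  have hE' : (1 : ℝ) ≤ E := by exact_mod_cast hE
  have hL : 0 ≤ xmax - xmin := by nlinarith
  let M' : Histogram n ε xmin xmax E :=
    { K := 1
      c := fun j => if j = 0 then xmin - ε / 2 else xmax + ε / 2
      h := fun _ => n
      K_pos := le_rfl
      c_mono := by
        intro j hj
        have : j = 0 := by omega
        subst this
        simp
        linarith
      c_first := by simp
      c_last := by simp
      c_grid := by
        intro j hj
        by_cases h : j = 0
        · exact ⟨0, by omega, by simp [h]⟩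
        · exact ⟨E, le_rfl, by simp [h]; linarith⟩
      h_sum := by simp }
  have hc : M'.Compatible D := by
    intro j hj
    have : j = 0 := by change j < 1 at hj; omega
    subst this
    have : (Finset.univ.filter fun i => D i ∈ Set.Ioc (M'.c 0) (M'.c (0 + 1))) = Finset.univ := by
      ext i
      simp only [Finset.mem_filter, Finset.mem_univ, true_and, iff_true, Set.mem_Ioc, M']
      simp
      constructor <;> linarith [hmin' i, hmax' i]
    have h2 : M'.h 0 = n := rfl
    rw [h2]
    convert congrArg Finset.card this using 1
    simp
  have hle := hM.2 M' hc
  have hv : M'.cEnum = logStar 1 + n * Real.log E := by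
    have : (xmax + ε / 2 - (xmin - ε / 2)) / ε = E := by rw [hEe]; field_simp; ring
    simp [Histogram.cEnum, M', this]
  have h1 := h9_logStar M.K
  have h2 := (h9_multi M).1
  have h3 := h9_sumnn hε M
  have h4 : 0 ≤ Real.log (Nat.choose (n + M.K - 1) (M.K - 1)) := Real.log_natCast_nonneg _
  have h5 : Real.log (Nat.choose (E + (n + 1)) (n + 1)) ≤
      Real.log (Nat.choose (E + M.K - 1) (M.K - 1)) := by
    apply Real.log_le_log
    · exact_mod_cast Nat.choose_pos (by omega)
    · have e : E + M.K - 1 = E + (M.K - 1) := by omega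
      rw [e]
      have := Nat.choose_le_choose E (show E + (n + 1) ≤ E + (M.K - 1) by omega)
      rw [Nat.choose_symm_add, Nat.choose_symm_add] at this
      exact_mod_cast this
  have h6 := h9_choose_lb E (n + 1) hE
  rw [hv] at hle
  simp only [Histogram.cEnum] at hle
  push_cast at h6
  linarith

/-- asymptotic behaviour of the Enum criterion of optimal
histograms as ε → 0. -/
theorem stmt9 {n : ℕ} (D : Fin n → ℝ) (hn : 1 ≤ n) (hdist : ∃ i j, D i ≠ D j)
    {xmin xmax : ℝ} (hxmin : IsGLB (Set.range D) xmin) (hxmax : IsLUB (Set.range D) xmax) :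
    ∃ C > (0 : ℝ), ∃ Ed > (0 : ℝ), ∀ ε : ℝ, 0 < ε → ε ≤ Ed →
      ∀ E : ℕ, 1 ≤ E → (E : ℝ) = 1 + (xmax - xmin) / ε →
        ∀ M : Histogram n ε xmin xmax E, M.Optimal D →
          |M.cEnum - (((M.K : ℝ) - 1 + (n : ℝ) - (Histogram.singCount D M : ℝ))
              * Real.log (1 / ε))| ≤ C := by
  classical
  obtain ⟨i0, j0, hij0⟩ := hdist
  have hne : (Set.range D).Nonempty := ⟨D i0, i0, rfl⟩
  have hmin : ∃ i, D i = xmin := by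
    have := hne.csInf_mem (Set.finite_range D)
    rwa [hxmin.csInf_eq hne] at this
  have hmax : ∃ i, D i = xmax := by
    have := hne.csSup_mem (Set.finite_range D)
    rwa [hxmax.csSup_eq hne] at this
  have hmin' : ∀ i, xmin ≤ D i := fun i => hxmin.1 ⟨i, rfl⟩
  have hmax' : ∀ i, D i ≤ xmax := fun i => hxmax.1 ⟨i, rfl⟩
  have hL : 0 < xmax - xmin := by
    rcases lt_or_gt_of_ne hij0 with h | h
    · linarith [hmin' i0, hmax' j0]
    · linarith [hmin' j0, hmax' i0]
  obtain ⟨δ, hδ, hgap⟩ := h9_gap D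
  set L := xmax - xmin with hLdef
  set κ := δ / (n + 1) with hκdef
  have hκ : 0 < κ := by positivity
  set A := logStar 1 + Real.log (Nat.factorial (n + 1)) with hA
  let F : ℕ → ℝ := fun K => |logStar K| + |Real.log (Nat.choose (n + K - 1) (K - 1))|
    + Real.log (Nat.factorial (K - 1))
  have hF0 : ∀ K, 0 ≤ F K := fun K => by
    have := Real.log_natCast_nonneg (Nat.factorial (K - 1))
    positivity
  let B := |Real.log κ| + |Real.log (L + 1)|
  let B2 := |Real.log L| + |Real.log (L + 1)|
  have hB : 0 ≤ B := by positivity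
  have hB2 : 0 ≤ B2 := by positivity
  have hl2 : 0 < Real.log 2 := Real.log_pos (by norm_num)
  have hnf := Real.log_natCast_nonneg (Nat.factorial n)
  have hS0 : 0 ≤ ∑ K ∈ Finset.range (n + 2), F K := Finset.sum_nonneg (fun K _ => hF0 K)
  refine ⟨∑ K ∈ Finset.range (n + 2), F K + Real.log (Nat.factorial n) + n * B2 + n * Real.log 2
    + n * B + 1, by positivity, min 1 (L * Real.exp (-(A + 1))), by positivity, ?_⟩
  intro ε hε hεd E hE hEe M hM
  have hε1 : ε ≤ 1 := hεd.trans (min_le_left _ _)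
  have hε2 : ε ≤ L * Real.exp (-(A + 1)) := hεd.trans (min_le_right _ _)
  set ℓ := Real.log (1 / ε) with hℓ
  have hlogdiv : ∀ w : ℝ, 0 < w → Real.log (w / ε) = Real.log w + ℓ := by
    intro w hw
    rw [hℓ, div_eq_mul_one_div, Real.log_mul hw.ne' (by positivity)]
  have hlogE : Real.log E = Real.log (L + ε) + ℓ := by
    rw [← hlogdiv _ (by linarith), hEe]
    congr 1
    field_simp
    ring
  have hLe : |Real.log (L + ε)| ≤ B2 := by
    have a : Real.log L ≤ Real.log (L + ε) := Real.log_le_log hL (by linarith)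
    have b : Real.log (L + ε) ≤ Real.log (L + 1) := Real.log_le_log (by linarith) (by linarith)
    rw [abs_le]
    have c1 := neg_abs_le (Real.log L)
    have c2 := le_abs_self (Real.log (L + 1))
    have c3 := abs_nonneg (Real.log L)
    have c4 := abs_nonneg (Real.log (L + 1))
    simp only [B2]
    constructor <;> linarith
  have hbig : A < Real.log E := by
    have h1 : Real.log ε ≤ Real.log L + -(A + 1) := by
      have := Real.log_le_log hε hε2
      rwa [Real.log_mul hL.ne' (Real.exp_pos _).ne', Real.log_exp] at this
    have h2 : ℓ = - Real.log ε := by rw [hℓ, one_div, Real.log_inv]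
    have a : Real.log L ≤ Real.log (L + ε) := Real.log_le_log hL (by linarith)
    linarith
  have hK : M.K ≤ n + 1 := h9_Kbound hε hE hEe D hmin' hmax' M hM hbig
  have hK1 := M.K_pos
  -- data term
  have hT : |∑ k ∈ Finset.range M.K, (M.h k : ℝ) * Real.log ((M.c (k + 1) - M.c k) / ε)
      - ((n : ℝ) - (Histogram.singCount D M : ℝ)) * ℓ| ≤ n * B := by
    have hn' : (n : ℝ) = ∑ k ∈ Finset.range M.K, (M.h k : ℝ) := by
      rw [← Nat.cast_sum, M.h_sum]
    have e : ((n : ℝ) - (Histogram.singCount D M : ℝ)) * ℓ =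
        ∑ k ∈ Finset.range M.K, ((M.h k : ℝ) - ((if M.c (k + 1) - M.c k = ε ∧ 0 < M.h k ∧
        ∀ i j : Fin n, D i ∈ Set.Ioc (M.c k) (M.c (k + 1)) →
          D j ∈ Set.Ioc (M.c k) (M.c (k + 1)) → D i = D j then M.h k else 0 : ℕ) : ℝ)) * ℓ := by
      rw [← Finset.sum_mul, Finset.sum_sub_distrib, ← hn', ← Nat.cast_sum]
      unfold Histogram.singCount
      congr!
    rw [e, ← Finset.sum_sub_distrib]
    refine (Finset.abs_sum_le_sum_abs _ _).trans ?_
    rw [show (n : ℝ) * B = ∑ k ∈ Finset.range M.K, (M.h k : ℝ) * B by rw [← Finset.sum_mul, ← hn']]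
    apply Finset.sum_le_sum
    intro k hk
    have hk' := Finset.mem_range.1 hk
    split_ifs with hs
    · rw [hs.1, div_self hε.ne']
      simp
      positivity
    · rcases Nat.eq_zero_or_pos (M.h k) with h0 | h0
      · simp [h0]
      · have hw := h9_wide hε D hmin hmax hmin' hmax' δ hδ hgap M hM k hk' h0 hs
        have hw2 : M.c (k + 1) - M.c k ≤ L + 1 := by
          have a := h9_mono M 0 k (by omega) hk'.le
          have b := h9_mono M (k + 1) M.K hk' le_rfl
          rw [M.c_first] at a
          rw [M.c_last] at b
          linarith
        have hw0 : 0 < M.c (k + 1) - M.c k := lt_of_lt_of_le hκ hw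
        have a := Real.log_le_log hκ hw
        have b := Real.log_le_log hw0 hw2
        rw [hlogdiv _ hw0]
        rw [show (M.h k : ℝ) * (Real.log (M.c (k + 1) - M.c k) + ℓ) - ((M.h k : ℝ) - ((0 : ℕ) : ℝ)) * ℓ
          = (M.h k : ℝ) * Real.log (M.c (k + 1) - M.c k) by push_cast; ring, abs_mul, Nat.abs_cast]
        gcongr
        rw [abs_le]
        have c1 := neg_abs_le (Real.log κ)
        have c2 := le_abs_self (Real.log (L + 1))
        have c3 := abs_nonneg (Real.log κ)
        have c4 := abs_nonneg (Real.log (L + 1))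
        simp only [B]
        constructor <;> linarith
  have hKc : ((M.K - 1 : ℕ) : ℝ) = (M.K : ℝ) - 1 := by rw [Nat.cast_sub hK1]; simp
  have hKn : ((M.K - 1 : ℕ) : ℝ) ≤ n := by exact_mod_cast (by omega : M.K - 1 ≤ n)
  have hK0 : (0 : ℝ) ≤ ((M.K - 1 : ℕ) : ℝ) := Nat.cast_nonneg _
  have hlb := h9_choose_lb E (M.K - 1) hE
  have hub := h9_choose_ub E (M.K - 1) hE
  rw [show E + (M.K - 1) = E + M.K - 1 by omega] at hlb hub
  have hFK : F M.K ≤ ∑ K ∈ Finset.range (n + 2), F K :=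
    Finset.single_le_sum (fun K _ => hF0 K) (Finset.mem_range.2 (by omega))
  have hm := h9_multi M
  have hq1 : |((M.K - 1 : ℕ) : ℝ) * Real.log (L + ε)| ≤ n * B2 := by
    rw [abs_mul, abs_of_nonneg hK0]
    gcongr
  have hq2 : ((M.K - 1 : ℕ) : ℝ) * Real.log 2 ≤ n * Real.log 2 := by gcongr
  rw [hlogE, mul_add] at hlb hub
  have hls := le_abs_self (logStar M.K)
  have hls2 := neg_abs_le (logStar M.K)
  have hcs := le_abs_self (Real.log (Nat.choose (n + M.K - 1) (M.K - 1)))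
  have hcs2 := neg_abs_le (Real.log (Nat.choose (n + M.K - 1) (M.K - 1)))
  have hkf := Real.log_natCast_nonneg (Nat.factorial (M.K - 1))
  have hFd : F M.K = |logStar M.K| + |Real.log (Nat.choose (n + M.K - 1) (M.K - 1))|
    + Real.log (Nat.factorial (M.K - 1)) := rfl
  have hn2 : 0 ≤ (n : ℝ) * Real.log 2 := by positivity
  rw [abs_le] at hT hq1 ⊢
  have eq : ((M.K : ℝ) - 1 + (n : ℝ) - (Histogram.singCount D M : ℝ)) * ℓ =
    ((M.K - 1 : ℕ) : ℝ) * ℓ + ((n : ℝ) - (Histogram.singCount D M : ℝ)) * ℓ := by rw [hKc]; ring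
  rw [eq]
  unfold Histogram.cEnum
  obtain ⟨hT1, hT2⟩ := hT
  obtain ⟨hq3, hq4⟩ := hq1
  obtain ⟨hm1, hm2⟩ := hm
  constructor <;> linarith
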